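/- Assume (A1), take α = 1, and suppose max_{x∈ℝ} f(x)g(x) < n − 1. Then an ε-limit quenching occurs: there do not exist a constant c* > 0 and a family (u^ε)_{ε∈(0,1)} of positive classical solutions of the scaled problem on ℝ × [0,∞) such that u^ε(x,t) ≥ ε c* for all ε ∈ (0,1) and all (x,t) ∈ ℝ × [0,∞). -/

import Mathlib

open Real Set Filter Topology

noncomputable section

/-- Partial derivative in the space variable `x`. -/
def pdx (u : ℝ → ℝ → ℝ) (x t : ℝ) : ℝ := deriv (fun y => u y t) x

/-- Second partial derivative in the space variable `x`. -/
def pdxx (u : ℝ → ℝ → ℝ) (x t : ℝ) : ℝ := deriv (fun y => pdx u y t) x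

/-- Partial derivative in the time variable `t`. -/
def pdt (u : ℝ → ℝ → ℝ) (x t : ℝ) : ℝ := deriv (fun s => u x s) t

/-- Assumption (A1): `f` is `C¹`, `ℤ`-periodic and positive; `g` is `C²`, `ℤ`-periodic
and positive. -/
def A1 (f g : ℝ → ℝ) : Prop :=
  ContDiff ℝ 1 f ∧ (∀ x, f (x + 1) = f x) ∧ (∀ x, 0 < f x) ∧
  ContDiff ℝ 2 g ∧ (∀ x, g (x + 1) = g x) ∧ (∀ x, 0 < g x)

/-- A positive classical solution of the scaled problem on `ℝ × [0, T)`, where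
`T : EReal` with `0 < T ≤ ∞`:
`u_t = u_xx/((u_x)² + 1) − (n−1)/u + (1/ε) f(x) √((u_x)² + 1)`, `u(x,0) = ε^α g(x)`. -/
structure IsSol (n : ℕ) (f g : ℝ → ℝ) (ε α : ℝ) (T : EReal) (u : ℝ → ℝ → ℝ) : Prop where
  pos : ∀ x t : ℝ, 0 ≤ t → (t : EReal) < T → 0 < u x t
  cont : ContinuousOn (fun p : ℝ × ℝ => u p.1 p.2)
    {p : ℝ × ℝ | 0 ≤ p.2 ∧ (p.2 : EReal) < T}
  smooth : ContDiffOn ℝ (⊤ : ℕ∞) (fun p : ℝ × ℝ => u p.1 p.2)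
    {p : ℝ × ℝ | 0 < p.2 ∧ (p.2 : EReal) < T}
  periodic : ∀ x t : ℝ, u (x + 1) t = u x t
  eqn : ∀ x t : ℝ, 0 < t → (t : EReal) < T →
    pdt u x t = pdxx u x t / ((pdx u x t) ^ 2 + 1) - ((n : ℝ) - 1) / u x t
      + (1 / ε) * f x * Real.sqrt ((pdx u x t) ^ 2 + 1)
  init : ∀ x : ℝ, u x 0 = ε ^ α * g x

/-- A function which is spatially periodic, initially negative and nonnegative somewhere later
vanishes for the first time at a point where it attains its maximum over the past. -/
theorem exists_first_zero {ψ : ℝ → ℝ → ℝ}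
    (hc : ContinuousOn (fun p : ℝ × ℝ => ψ p.1 p.2) {p : ℝ × ℝ | 0 ≤ p.2})
    (hp : ∀ x t, ψ (x + 1) t = ψ x t) (h0 : ∀ x, ψ x 0 < 0)
    {x₁ t₁ : ℝ} (ht₁ : 0 ≤ t₁) (h1 : 0 ≤ ψ x₁ t₁) :
    ∃ x₀ t₀, 0 < t₀ ∧ ψ x₀ t₀ = 0 ∧ ∀ x t, 0 ≤ t → t ≤ t₀ → ψ x t ≤ 0 := by
  have hrep : ∀ x t, ∃ y ∈ Icc (0 : ℝ) 1, ψ x t = ψ y t := fun x t => by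
    obtain ⟨y, hy, h⟩ := Function.Periodic.exists_mem_Ico₀ (f := fun x => ψ x t)
      (fun x => hp x t) one_pos x
    exact ⟨y, Ico_subset_Icc_self hy, h⟩
  have hbox : Icc (0 : ℝ) 1 ×ˢ Icc 0 t₁ ⊆ {p : ℝ × ℝ | 0 ≤ p.2} := fun p hp => hp.2.1
  set K : Set (ℝ × ℝ) :=
    (Icc (0 : ℝ) 1 ×ˢ Icc 0 t₁) ∩ (fun p : ℝ × ℝ => ψ p.1 p.2) ⁻¹' Ici 0 with hK
  have hKc : IsCompact K :=
    (isCompact_Icc.prod isCompact_Icc).of_isClosed_subset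
      ((hc.mono hbox).preimage_isClosed_of_isClosed
        (isClosed_Icc.prod isClosed_Icc) isClosed_Ici) inter_subset_left
  have hKne : K.Nonempty := by
    obtain ⟨y, hy, h⟩ := hrep x₁ t₁
    exact ⟨(y, t₁), ⟨hy, ht₁, le_rfl⟩, h1.trans_eq h⟩
  obtain ⟨⟨x₀, t₀⟩, ⟨⟨-, ht₀, ht₀₁⟩, hψ⟩, hmin⟩ :=
    hKc.exists_isMinOn hKne continuous_snd.continuousOn
  simp only [mem_preimage, mem_Ici] at hψ ht₀ ht₀₁
  have hpos : 0 < t₀ := by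
    rcases ht₀.eq_or_lt with h | h
    · subst h
      exact absurd (h0 x₀) hψ.not_gt
    · exact h
  have hlt : ∀ x t, 0 ≤ t → t < t₀ → ψ x t < 0 := fun x t h h' => by
    by_contra! hcon
    obtain ⟨y, hy, hxy⟩ := hrep x t
    have : t₀ ≤ t :=
      hmin (show (y, t) ∈ K from ⟨⟨hy, h, h'.le.trans ht₀₁⟩, by
        simpa [← hxy] using hcon⟩)
    exact this.not_gt h'
  have hle : ∀ x, ψ x t₀ ≤ 0 := fun x => by
    have hct : ContinuousWithinAt (fun t => ψ x t) (Ioo 0 t₀) t₀ :=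
      (hc (x, t₀) ht₀).comp (f := fun t : ℝ => (x, t)) (by fun_prop) fun t ht => ht.1.le
    have : (𝓝[Ioo 0 t₀] t₀).NeBot := by
      rw [← mem_closure_iff_nhdsWithin_neBot, closure_Ioo hpos.ne]
      exact ⟨hpos.le, le_rfl⟩
    exact le_of_tendsto hct (eventually_nhdsWithin_of_forall fun t ht => (hlt x t ht.1.le ht.2).le)
  refine ⟨x₀, t₀, hpos, (hle x₀).antisymm hψ, fun x t h h' => ?_⟩
  rcases h'.eq_or_lt with rfl | h'
  · exact hle x
  · exact (hlt x t h h').le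

/-- The second derivative is nonpositive at a local maximum. -/
theorem IsLocalMax.deriv_deriv_nonpos {h : ℝ → ℝ} {x : ℝ} (hm : IsLocalMax h x)
    (hc : ContinuousAt h x) : deriv (deriv h) x ≤ 0 := by
  by_contra! hpos
  have hmin := isLocalMin_of_deriv_deriv_pos hpos hm.deriv_eq_zero hc
  have heq : h =ᶠ[𝓝 x] fun _ => h x := by
    filter_upwards [hm, hmin] with y h1 h2 using le_antisymm h1 h2
  have hd := heq.deriv.deriv_eq
  simp at hd
  exact hpos.ne' hd

/-- The derivative is nonnegative at a maximum over the past. -/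
theorem HasDerivAt.nonneg_of_eventually_le_left {h : ℝ → ℝ} {d t : ℝ} (hd : HasDerivAt h d t)
    (hle : ∀ᶠ s in 𝓝[<] t, h s ≤ h t) : 0 ≤ d := by
  have hs := (hasDerivWithinAt_iff_tendsto_slope' (s := Iio t) (by simp)).1 hd.hasDerivWithinAt
  refine ge_of_tendsto hs ?_
  filter_upwards [hle, self_mem_nhdsWithin] with s h1 h2
  rw [slope_def_field]
  exact div_nonneg_of_nonpos (sub_nonpos.2 h1) (sub_nonpos.2 (le_of_lt h2))

/-- A continuous `1`-periodic real function is bounded in absolute value. -/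
theorem Function.Periodic.exists_abs_le {h : ℝ → ℝ} (hp : Function.Periodic h 1)
    (hc : Continuous h) : ∃ C, 0 < C ∧ ∀ x, |h x| ≤ C := by
  obtain ⟨C, hC⟩ := (hp.isBounded_of_continuous one_ne_zero hc).exists_norm_le
  exact ⟨max C 1, by positivity, fun x => (hC _ (mem_range_self x)).trans (le_max_left _ _)⟩

theorem Function.Periodic.deriv {h : ℝ → ℝ} {c : ℝ} (hp : Function.Periodic h c) :
    Function.Periodic (deriv h) c := fun x => by
  rw [← deriv_comp_add_const, hp.funext]

theorem Real.sqrt_sq_add_one_le (a : ℝ) : √(a ^ 2 + 1) ≤ 1 + |a| :=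
  Real.sqrt_le_iff.2 ⟨by positivity, by nlinarith [sq_abs a, abs_nonneg a]⟩

section Solution

variable {n : ℕ} {f g : ℝ → ℝ} {ε α : ℝ} {u : ℝ → ℝ → ℝ}

theorem IsSol.contDiffAt (hu : IsSol n f g ε α ⊤ u) {x t : ℝ} (ht : 0 < t) :
    ContDiffAt ℝ (⊤ : ℕ∞) (fun p : ℝ × ℝ => u p.1 p.2) (x, t) := by
  refine hu.smooth.contDiffAt (IsOpen.mem_nhds ?_ ⟨ht, EReal.coe_lt_top t⟩)
  simpa [EReal.coe_lt_top] using isOpen_lt continuous_const continuous_snd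

theorem IsSol.contDiff_space (hu : IsSol n f g ε α ⊤ u) {t : ℝ} (ht : 0 < t) :
    ContDiff ℝ (⊤ : ℕ∞) (fun x => u x t) :=
  contDiff_iff_contDiffAt.2 fun x =>
    (hu.contDiffAt ht).comp x (f := fun x : ℝ => (x, t)) (by fun_prop)

theorem IsSol.hasDerivAt_time (hu : IsSol n f g ε α ⊤ u) {x t : ℝ} (ht : 0 < t) :
    HasDerivAt (fun s => u x s) (pdt u x t) t :=
  (((hu.contDiffAt ht).comp t (f := fun s : ℝ => (x, s)) (by fun_prop)).differentiableAt
    (by simp)).hasDerivAt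

/-- If a solution reaches the descending barrier `ε (g + η) - k t`, then at the first contact
point the barrier is not a strict supersolution. -/
theorem IsSol.exists_contact (hu : IsSol n f g ε 1 ⊤ u) (hε : 0 < ε) (hg : ContDiff ℝ 2 g)
    (hgp : ∀ x, g (x + 1) = g x) {η k : ℝ} (hη : 0 < η) (hk : 0 < k) :
    ∃ x t, 0 < t ∧ u x t ≤ ε * (g x + η) ∧ -k ≤ pdt u x t ∧
      pdx u x t = ε * deriv g x ∧ pdxx u x t ≤ ε * deriv (deriv g) x := by
  set ψ : ℝ → ℝ → ℝ := fun x t => u x t - (ε * (g x + η) - k * t) with hψ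
  have hgc := hg.continuous
  have hcont : ContinuousOn (fun p : ℝ × ℝ => ψ p.1 p.2) {p : ℝ × ℝ | 0 ≤ p.2} := by
    have := hu.cont
    simp only [EReal.coe_lt_top, and_true] at this
    exact this.sub (by fun_prop)
  obtain ⟨x, t, ht, hzero, hmax⟩ := exists_first_zero (x₁ := 0) (t₁ := |ε * (g 0 + η)| / k) hcont
    (fun x t => by simp only [hψ, hu.periodic, hgp])
    (fun x => by
      simp only [hψ, hu.init, Real.rpow_one]
      nlinarith [mul_pos hε hη])
    (by positivity)
    (by
      have h1 := hu.pos 0 (|ε * (g 0 + η)| / k) (by positivity) (EReal.coe_lt_top _)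
      have h2 := le_abs_self (ε * (g 0 + η))
      simp only [hψ]
      rw [mul_div_cancel₀ _ hk.ne']
      linarith)
  have hzero' : u x t = ε * (g x + η) - k * t := by simpa [hψ, sub_eq_zero] using hzero
  have hus := hu.contDiff_space ht
  have hlm : IsLocalMax (fun y => ψ y t) x :=
    Eventually.of_forall fun y => (hmax y t ht.le le_rfl).trans_eq hzero.symm
  have hud : Differentiable ℝ (fun y => u y t) := hus.differentiable (by simp)
  have hgd : Differentiable ℝ g := hg.differentiable (by simp)
  have hud2 : Differentiable ℝ (fun y => pdx u y t) :=
    (contDiff_infty.1 hus 2).differentiable_deriv_two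
  have hgd2 : Differentiable ℝ (deriv g) := hg.differentiable_deriv_two
  have hd1 : ∀ y, HasDerivAt (fun y => ψ y t) (pdx u y t - ε * deriv g y) y := fun y =>
    (hud y).hasDerivAt.sub ((((hgd y).hasDerivAt.add_const η).const_mul ε).sub_const (k * t))
  have hd2 : HasDerivAt (deriv fun y => ψ y t) (pdxx u x t - ε * deriv (deriv g) x) x := by
    rw [deriv_eq hd1]
    exact (hud2 x).hasDerivAt.sub ((hgd2 x).hasDerivAt.const_mul ε)
  have htime : HasDerivAt (fun s => ψ x s) (pdt u x t + k) t := by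
    refine ((hu.hasDerivAt_time ht).sub
      (((hasDerivAt_id t).const_mul k).const_sub (ε * (g x + η)))).congr_deriv ?_
    ring
  refine ⟨x, t, ht, ?_, ?_, ?_, ?_⟩
  · rw [hzero']
    nlinarith [mul_pos hk ht]
  · have := htime.nonneg_of_eventually_le_left (by
      filter_upwards [Ioo_mem_nhdsLT ht] with s hs
      exact (hmax x s hs.1.le hs.2.le).trans_eq hzero.symm)
    linarith
  · have := hlm.hasDerivAt_eq_zero (hd1 x)
    linarith
  · have := hlm.deriv_deriv_nonpos (hd1 x).continuousAt
    rw [hd2.deriv] at this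
    linarith

end Solution

/-- Under (A1), for `α = 1`, if `max_{x} f(x)g(x) < n − 1` then an ε-limit
quenching occurs: there is no constant `c* > 0` together with a family `(u^ε)_{ε∈(0,1)}`
of positive classical solutions of the scaled problem on `ℝ × [0,∞)` with
`u^ε(x,t) ≥ ε c*` for all `ε ∈ (0,1)` and all `(x,t) ∈ ℝ × [0,∞)`. -/
theorem eps_limit_quenching (n : ℕ) (hn : 2 ≤ n) (f g : ℝ → ℝ) (hA1 : A1 f g)
    (hfg : sSup (Set.range fun x => f x * g x) < (n : ℝ) - 1) :
    ¬ ∃ cs : ℝ, 0 < cs ∧ ∃ u : ℝ → (ℝ → ℝ → ℝ),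
      ∀ ε : ℝ, 0 < ε → ε < 1 →
        IsSol n f g ε 1 ⊤ (u ε) ∧
        ∀ x t : ℝ, 0 ≤ t → ε * cs ≤ u ε x t := by
  rintro ⟨cs, -, u, hu⟩
  obtain ⟨hf, hfp, hf0, hg, hgp, hg0⟩ := hA1
  obtain ⟨F, hF, hfF⟩ := Function.Periodic.exists_abs_le hfp hf.continuous
  obtain ⟨G, hG, hgG⟩ := Function.Periodic.exists_abs_le hgp hg.continuous
  obtain ⟨A, hA, hgA⟩ := (Function.Periodic.deriv hgp).exists_abs_le
    (hg.continuous_deriv (by norm_num))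
  obtain ⟨B, hB, hgB⟩ := (Function.Periodic.deriv hgp).deriv.exists_abs_le
    ((hg.deriv' (n := 1)).continuous_deriv le_rfl)
  have hbdd : BddAbove (range fun x => f x * g x) := ⟨F * G, by
    rintro _ ⟨x, rfl⟩
    exact mul_le_mul ((le_abs_self _).trans (hfF x)) ((le_abs_self _).trans (hgG x))
      (hg0 x).le hF.le⟩
  obtain ⟨δ, hδ, hδM⟩ : ∃ δ, 0 < δ ∧ ∀ x, f x * g x + 2 * δ ≤ (n : ℝ) - 1 :=
    ⟨((n : ℝ) - 1 - sSup (range fun x => f x * g x)) / 2, by linarith, fun x => by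
      have := le_csSup hbdd (mem_range_self x)
      linarith⟩
  -- `g + η` still satisfies `f (g + η) < n - 1`, and `κ` is the descent rate of the barrier.
  set η := δ / F with hη_def
  have hη : 0 < η := by positivity
  set κ := δ / (2 * (G + η)) with hκ_def
  have hκ : 0 < κ := by positivity
  set ε := min (1 / 2) (κ / (2 * (B + F * A))) with hε_def
  have hε : 0 < ε := by positivity
  have hε1 : ε < 1 := (min_le_left _ _).trans_lt (by norm_num)
  have hεC : ε * (B + F * A) < κ := by
    have h1 : ε ≤ κ / (2 * (B + F * A)) := min_le_right _ _
    rw [le_div_iff₀ (by positivity)] at h1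
    linarith
  obtain ⟨hsol, -⟩ := hu ε hε hε1
  obtain ⟨x, t, ht, hle, hpt, hpx, hpxx⟩ :=
    hsol.exists_contact hε hg hgp hη (k := κ / ε) (by positivity)
  have heq := hsol.eqn x t ht (EReal.coe_lt_top t)
  have hupos := hsol.pos x t ht.le (EReal.coe_lt_top t)
  have hgη : 0 < g x + η := add_pos (hg0 x) hη
  have hfx : f x ≤ F := (le_abs_self _).trans (hfF x)
  have hdiff : pdxx (u ε) x t / ((pdx (u ε) x t) ^ 2 + 1) ≤ ε * B := by
    rw [div_le_iff₀ (by positivity)]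
    have h1 : ε * deriv (deriv g) x ≤ ε * B :=
      mul_le_mul_of_nonneg_left ((le_abs_self _).trans (hgB x)) hε.le
    have h2 : 0 ≤ ε * B * (pdx (u ε) x t) ^ 2 := by positivity
    linarith
  have hsqrt : √((pdx (u ε) x t) ^ 2 + 1) ≤ 1 + ε * A := by
    refine (Real.sqrt_sq_add_one_le _).trans ?_
    rw [hpx, abs_mul, abs_of_pos hε]
    gcongr
    exact hgA x
  have hreact : (f x + 2 * κ) / ε ≤ ((n : ℝ) - 1) / u ε x t := by
    have h1 : f x * η ≤ δ := by
      calc f x * η ≤ F * η := by gcongr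
        _ = δ := by rw [hη_def]; field_simp
    have h2 : 2 * κ * (g x + η) ≤ δ := by
      calc 2 * κ * (g x + η) ≤ 2 * κ * (G + η) := by
            gcongr
            exact (le_abs_self _).trans (hgG x)
        _ = δ := by rw [hκ_def]; field_simp
    have hf2 : 0 ≤ f x + 2 * κ := by linarith [hf0 x]
    rw [div_le_div_iff₀ hε hupos]
    nlinarith [mul_le_mul_of_nonneg_left hle hf2, hδM x]
  have hforce : 1 / ε * f x * √((pdx (u ε) x t) ^ 2 + 1) ≤ f x / ε + F * A := by
    have h0 := hf0 x
    calc 1 / ε * f x * √((pdx (u ε) x t) ^ 2 + 1) ≤ 1 / ε * f x * (1 + ε * A) := by gcongr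
      _ = f x / ε + f x * A := by field_simp
      _ ≤ f x / ε + F * A := by gcongr
  have hκε : κ / ε ≤ ε * B + F * A := by
    have : (f x + 2 * κ) / ε = f x / ε + 2 * (κ / ε) := by ring
    linarith
  rw [div_le_iff₀ hε] at hκε
  nlinarith [mul_pos hε hB]
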